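/- For t ≥ 4, an n-vertex P_t-subgraph-free graph G has exactly ((t−2)/2)·n edges if and only if G is a vertex-disjoint union of complete graphs K_{t−1} (in particular n is divisible by t−1). -/

import Mathlib

/-- `Contains G F` means `G` has a subgraph isomorphic to `F` (a copy of `F`),
i.e. there is an injective graph homomorphism from `F` to `G`. -/
def Contains {α β : Type*} (G : SimpleGraph α) (F : SimpleGraph β) : Prop :=
  ∃ f : β → α, Function.Injective f ∧ ∀ u v : β, F.Adj u v → G.Adj (f u) (f v)


namespace SimpleGraph

variable {V : Type*} [DecidableEq V] (G : SimpleGraph V) [DecidableRel G.Adj]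

/-- The number of neighbours of `v` in the finite set `S`. -/
def degreeIn (S : Finset V) (v : V) : ℕ := (S.filter (G.Adj v)).card

variable {G}

omit [DecidableEq V] [DecidableRel G.Adj] in
lemma length_lt_of_not_contains_pathGraph {t : ℕ} (hfree : ¬ Contains G (pathGraph t))
    {l : List V} (hn : l.Nodup) (hc : l.IsChain G.Adj) : l.length < t := by
  by_contra! h
  refine hfree ⟨fun i => l[i.1]'(i.2.trans_le h), fun i j hij => ?_, fun i j hij => ?_⟩
  · exact Fin.ext ((hn.getElem_inj_iff).1 hij)
  · rw [List.isChain_iff_getElem] at hc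
    rcases pathGraph_adj.1 hij with h1 | h1
    · have := hc i.1 (by omega)
      simpa [h1] using this
    · have := hc j.1 (by omega)
      simpa [h1] using this.symm

lemma sum_degreeIn_erase {S : Finset V} {v : V} (hv : v ∈ S) :
    ∑ w ∈ S.erase v, G.degreeIn (S.erase v) w + 2 * G.degreeIn S v =
      ∑ w ∈ S, G.degreeIn S w := by
  have hw (w : V) : G.degreeIn S w =
      (if G.Adj v w then 1 else 0) + G.degreeIn (S.erase v) w := by
    simp only [degreeIn, Finset.card_filter, G.adj_comm v w]
    rw [Finset.add_sum_erase S (fun u => if G.Adj w u then 1 else 0) hv]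
  have hv' : G.degreeIn S v = ∑ w ∈ S.erase v, if G.Adj v w then 1 else 0 := by
    rw [hw v]
    simp only [degreeIn, Finset.card_filter, SimpleGraph.irrefl, if_false, zero_add]
  rw [← Finset.add_sum_erase S _ hv, Finset.sum_congr rfl (fun w _ => hw w),
    Finset.sum_add_distrib, ← hv']
  ring

omit [DecidableEq V] [DecidableRel G.Adj] in
lemma IsClique.isChain_toList {s : Finset V} (h : G.IsClique s) : s.toList.IsChain G.Adj := by
  refine List.Pairwise.isChain ?_
  refine List.Pairwise.imp_of_mem ?_ s.nodup_toList
  intro a b ha hb hab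
  exact h (by simpa using ha) (by simpa using hb) hab

/-- The conclusion of Pósa's rotation argument: a maximum path whose two end vertices have large
total degree can be rearranged into a path whose end vertices are adjacent. -/
lemma exists_closed_perm {S : Finset V} {l : List V} (hne : l ≠ [])
    (hc : l.IsChain G.Adj)
    (hhead : ∀ w ∈ S, G.Adj (l.head hne) w → w ∈ l)
    (hlast : ∀ w ∈ S, G.Adj (l.getLast hne) w → w ∈ l)
    (hdeg : l.length ≤ G.degreeIn S (l.head hne) + G.degreeIn S (l.getLast hne)) :
    ∃ c : List V, c.Perm l ∧ c.IsChain G.Adj ∧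
      ∀ x ∈ c.getLast?, ∀ y ∈ c.head?, G.Adj x y := by
  set x := l.head hne with hx
  set y := l.getLast hne with hy
  have hpos : 0 < l.length := List.length_pos_iff.2 hne
  have hx0 : l[0] = x := by rw [hx, List.head_eq_getElem]
  have hyl : l[l.length - 1] = y := by rw [hy, List.getLast_eq_getElem]
  set A := (Finset.range (l.length - 1)).filter (fun i => G.Adj x (l.getD (i + 1) x)) with hA
  set B := (Finset.range (l.length - 1)).filter (fun i => G.Adj y (l.getD i x)) with hB
  have hAc : G.degreeIn S x ≤ A.card := by
    refine (Finset.card_le_card ?_).trans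
      (Finset.card_image_le (f := fun i => l.getD (i + 1) x) (s := A))
    intro w hw
    obtain ⟨hwS, hxw⟩ := Finset.mem_filter.1 hw
    obtain ⟨i, hi, rfl⟩ := List.mem_iff_getElem.1 (hhead w hwS hxw)
    have hi0 : i ≠ 0 := by
      rintro rfl
      exact G.loopless.irrefl x (hx0 ▸ hxw)
    obtain ⟨j, rfl⟩ := Nat.exists_eq_succ_of_ne_zero hi0
    have hj : l.getD (j + 1) x = l[j + 1] := List.getD_eq_getElem _ _ hi
    refine Finset.mem_image.2 ⟨j, Finset.mem_filter.2 ⟨Finset.mem_range.2 (by omega), ?_⟩, hj⟩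
    rw [hj]
    exact hxw
  have hBc : G.degreeIn S y ≤ B.card := by
    refine (Finset.card_le_card ?_).trans
      (Finset.card_image_le (f := fun i => l.getD i x) (s := B))
    intro w hw
    obtain ⟨hwS, hyw⟩ := Finset.mem_filter.1 hw
    obtain ⟨i, hi, rfl⟩ := List.mem_iff_getElem.1 (hlast w hwS hyw)
    have hi0 : i ≠ l.length - 1 := by
      rintro rfl
      exact G.loopless.irrefl y (hyl ▸ hyw)
    have hj : l.getD i x = l[i] := List.getD_eq_getElem _ _ hi
    refine Finset.mem_image.2 ⟨i, Finset.mem_filter.2 ⟨Finset.mem_range.2 (by omega), ?_⟩, hj⟩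
    rw [hj]
    exact hyw
  obtain ⟨i, hi⟩ : (A ∩ B).Nonempty := by
    rw [← Finset.card_pos]
    have h1 := Finset.card_union_add_card_inter A B
    have h2 : (A ∪ B).card ≤ l.length - 1 := by
      simpa using Finset.card_le_card (Finset.union_subset (Finset.filter_subset _ _)
        (Finset.filter_subset _ _) : A ∪ B ⊆ Finset.range (l.length - 1))
    omega
  obtain ⟨hiA, hiB⟩ := Finset.mem_inter.1 hi
  obtain ⟨hil, hxi⟩ := Finset.mem_filter.1 hiA
  obtain ⟨-, hyi⟩ := Finset.mem_filter.1 hiB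
  have hil' : i + 1 < l.length := by
    have := Finset.mem_range.1 hil
    omega
  rw [List.getD_eq_getElem _ _ hil'] at hxi
  rw [List.getD_eq_getElem _ _ (by omega)] at hyi
  have hsplit := List.take_append_drop (i + 1) l
  refine ⟨l.take (i + 1) ++ (l.drop (i + 1)).reverse, ?_, ?_, ?_⟩
  · nth_rewrite 3 [← hsplit]
    exact (List.reverse_perm _).append_left _
  · rw [List.isChain_append]
    refine ⟨hc.take _, ?_, ?_⟩
    · rw [List.isChain_reverse]
      exact (hc.drop _).imp fun a b h => h.symm
    · intro a ha b hb
      have ha' : a = l[i] := by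
        simp [List.getLast?_take] at ha
        grind
      have hb' : b = y := by
        simp [List.getLast?_drop] at hb
        grind
      rw [ha', hb']
      exact hyi.symm
  · intro a ha b hb
    have ha' : a = l[i + 1] := by
      simp [List.getLast?_append] at ha
      grind
    have hb' : b = x := by
      rw [List.head?_append_of_ne_nil _ (by simp [hne]), List.head?_take,
        if_neg (Nat.succ_ne_zero i), List.head?_eq_some_head hne] at hb
      exact (Option.mem_some_iff.1 hb).symm
    rw [ha', hb']
    exact hxi.symm

omit [DecidableEq V] [DecidableRel G.Adj] in
/-- A path with adjacent end vertices extends to a longer path through any outside neighbour. -/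
lemma exists_longer_chain {c : List V} (hn : c.Nodup) (hc : c.IsChain G.Adj)
    (hclosed : ∀ x ∈ c.getLast?, ∀ y ∈ c.head?, G.Adj x y)
    {z w : V} (hz : z ∈ c) (hw : w ∉ c) (hwz : G.Adj w z) :
    ∃ l : List V, l.Perm (w :: c) ∧ l.Nodup ∧ l.IsChain G.Adj := by
  obtain ⟨p, q, rfl⟩ := List.append_of_mem hz
  have hperm : (w :: ((z :: q) ++ p)).Perm (w :: (p ++ z :: q)) :=
    List.perm_append_comm.cons w
  refine ⟨w :: ((z :: q) ++ p), hperm, ?_, ?_⟩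
  · exact hperm.nodup_iff.2 (List.nodup_cons.2 ⟨hw, hn⟩)
  · rw [List.isChain_append] at hc
    have h2 : ((z :: q) ++ p).IsChain G.Adj := by
      rw [List.isChain_append]
      refine ⟨hc.2.1, hc.1, fun a ha b hb => hclosed a ?_ b ?_⟩
      · rw [List.getLast?_append]
        simp_all
      · rw [List.head?_append]
        simp_all
    rw [List.cons_append] at h2 ⊢
    exact List.isChain_cons_cons.2 ⟨hwz, h2⟩

/-- In a finite vertex set with all inner degrees large, a nonempty subset of fewer than `t`
vertices is closed under adjacency whenever no path has `t` vertices. -/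
lemma exists_closed_subset {t : ℕ}
    (hfree : ∀ l : List V, l.Nodup → l.IsChain G.Adj → l.length < t)
    {S : Finset V} (hS : S.Nonempty) (hdeg : ∀ v ∈ S, t ≤ 2 * G.degreeIn S v + 1) :
    ∃ C ⊆ S, C.Nonempty ∧ C.card < t ∧ ∀ v ∈ C, ∀ w ∈ S, G.Adj v w → w ∈ C := by
  obtain ⟨s, hs⟩ := hS
  let P : ℕ → Prop := fun m =>
    ∃ l : List V, l.Nodup ∧ l.IsChain G.Adj ∧ (∀ v ∈ l, v ∈ S) ∧ l.length = m
  have hP1 : P 1 := ⟨[s], by simp, by simp, by simpa using hs, rfl⟩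
  have hPb : ∀ m, P m → m ≤ t := by
    rintro m ⟨l, hn, hc, -, rfl⟩
    exact (hfree l hn hc).le
  classical
  have hPm : P (Nat.findGreatest P t) := Nat.findGreatest_spec (hPb 1 hP1) hP1
  have hmax : ∀ l : List V, l.Nodup → l.IsChain G.Adj → (∀ v ∈ l, v ∈ S) →
      l.length ≤ Nat.findGreatest P t := fun l hn hc hl =>
    Nat.le_findGreatest (hfree l hn hc).le ⟨l, hn, hc, hl, rfl⟩
  have hm1 : 1 ≤ Nat.findGreatest P t := Nat.le_findGreatest (hPb 1 hP1) hP1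
  obtain ⟨l, hn, hc, hlS, hlen⟩ := hPm
  rw [← hlen] at hmax hm1
  have hne : l ≠ [] := List.length_pos_iff.1 hm1
  have hlt := hfree l hn hc
  obtain ⟨c, hcl, hcc, hclosed⟩ := exists_closed_perm (S := S) hne hc
    (fun w hw hadj => by
      by_contra hwl
      have := hmax (w :: l) (List.nodup_cons.2 ⟨hwl, hn⟩)
        (List.isChain_cons.2 ⟨fun y hy => by
          rw [List.head?_eq_some_head hne] at hy
          cases hy
          exact hadj.symm, hc⟩)
        (by simpa [hw] using hlS)
      simp at this)
    (fun w hw hadj => by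
      by_contra hwl
      have := hmax (l ++ [w]) (by
          rw [List.nodup_append]
          exact ⟨hn, by simp, by simp; rintro a ha rfl; exact hwl ha⟩)
        (List.isChain_append.2 ⟨hc, by simp, fun y hy z hz => by
          rw [List.getLast?_eq_some_getLast hne] at hy
          cases hy
          simp at hz
          exact hz ▸ hadj⟩)
        (by
          intro v hv
          rcases List.mem_append.1 hv with h | h
          · exact hlS v h
          · rw [List.mem_singleton.1 h]
            exact hw)
      simp at this)
    (by
      have h1 := hdeg _ (hlS _ (List.head_mem hne))
      have h2 := hdeg _ (hlS _ (List.getLast_mem hne))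
      omega)
  have hcn : c.Nodup := hcl.nodup_iff.2 hn
  refine ⟨c.toFinset, ?_, ?_, ?_, ?_⟩
  · intro v hv
    exact hlS v (hcl.mem_iff.1 (List.mem_toFinset.1 hv))
  · exact ⟨l.head hne, List.mem_toFinset.2 (hcl.mem_iff.2 (List.head_mem hne))⟩
  · rw [List.toFinset_card_of_nodup hcn, hcl.length_eq]
    exact hlt
  · intro v hv w hw hvw
    by_contra hwc
    rw [List.mem_toFinset] at hv hwc
    obtain ⟨l', hl', hn', hc'⟩ := exists_longer_chain hcn hcc hclosed hv hwc hvw.symm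
    have := hmax l' hn' hc' (by
      intro u hu
      rcases List.mem_cons.1 (hl'.mem_iff.1 hu) with rfl | h
      · exact hw
      · exact hlS u (hcl.mem_iff.1 h))
    rw [hl'.length_eq, List.length_cons, hcl.length_eq] at this
    omega

/-- A finite vertex set inducing a graph with average degree at least `t - 2` and with no path on
`t` vertices induces a disjoint union of complete graphs on `t - 1` vertices. -/
lemma degreeIn_eq_and_adj_trans {t : ℕ} (ht : 3 ≤ t)
    (hfree : ∀ l : List V, l.Nodup → l.IsChain G.Adj → l.length < t) (S : Finset V)
    (hS : (t - 2) * S.card ≤ ∑ v ∈ S, G.degreeIn S v) :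
    (∀ v ∈ S, G.degreeIn S v = t - 2) ∧
      ∀ u ∈ S, ∀ v ∈ S, ∀ w ∈ S, G.Adj u v → G.Adj v w → u ≠ w → G.Adj u w := by
  induction S using Finset.strongInduction with
  | H S ih =>
  by_cases hdeg : ∀ v ∈ S, t ≤ 2 * G.degreeIn S v + 1
  · rcases S.eq_empty_or_nonempty with rfl | hne
    · simp
    obtain ⟨C, hCS, hCne, hCt, hC⟩ := exists_closed_subset hfree hne hdeg
    have hC' : ∀ v ∈ S \ C, ∀ w ∈ S, G.Adj v w → w ∈ S \ C := fun v hv w hw hvw =>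
      Finset.mem_sdiff.2 ⟨hw, fun hwC => (Finset.mem_sdiff.1 hv).2
        (hC w hwC v (Finset.mem_sdiff.1 hv).1 hvw.symm)⟩
    have hdS : ∀ v ∈ S \ C, G.degreeIn (S \ C) v = G.degreeIn S v := by
      intro v hv
      refine congrArg Finset.card (Finset.ext fun w => ?_)
      simp only [Finset.mem_filter]
      exact ⟨fun h => ⟨(Finset.mem_sdiff.1 h.1).1, h.2⟩, fun h => ⟨hC' v hv w h.1 h.2, h.2⟩⟩
    have hsub : ∀ v ∈ C, S.filter (G.Adj v) ⊆ C.erase v := by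
      intro v hv w hw
      obtain ⟨h1, h2⟩ := Finset.mem_filter.1 hw
      exact Finset.mem_erase.2 ⟨h2.ne', hC v hv w h1 h2⟩
    have hdC : ∀ v ∈ C, G.degreeIn S v ≤ t - 2 := by
      intro v hv
      have := Finset.card_le_card (hsub v hv)
      rw [Finset.card_erase_of_mem hv] at this
      rw [degreeIn]
      omega
    have hsumD : ∑ v ∈ S \ C, G.degreeIn (S \ C) v = ∑ v ∈ S \ C, G.degreeIn S v :=
      Finset.sum_congr rfl hdS
    have hsum := Finset.sum_sdiff (f := G.degreeIn S) hCS
    have hcard := Finset.card_sdiff_add_card_eq_card hCS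
    have hsumC : ∑ v ∈ C, G.degreeIn S v ≤ ∑ _v ∈ C, (t - 2) := Finset.sum_le_sum hdC
    have hmul : (t - 2) * S.card = (t - 2) * (S \ C).card + (t - 2) * C.card := by
      rw [← hcard, mul_add]
    have hconst : ∑ _v ∈ C, (t - 2) = (t - 2) * C.card := by simp [mul_comm]
    obtain ⟨ih1, ih2⟩ := ih (S \ C) (Finset.sdiff_ssubset hCS hCne) (by
      rw [hsumD]
      omega)
    have hsum' : ∑ v ∈ S \ C, G.degreeIn S v = (t - 2) * (S \ C).card := by
      rw [← hsumD, Finset.sum_congr rfl ih1]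
      simp [mul_comm]
    have hCeq : ∀ v ∈ C, G.degreeIn S v = t - 2 :=
      (Finset.sum_eq_sum_iff_of_le hdC).1 (by omega)
    have hclique : ∀ v ∈ C, ∀ w ∈ C, v ≠ w → G.Adj v w := by
      intro v hv w hw hvw
      have h := Finset.eq_of_subset_of_card_le (hsub v hv) (by
        have := hCeq v hv
        rw [degreeIn] at this
        rw [Finset.card_erase_of_mem hv]
        omega)
      have hw' : w ∈ C.erase v := Finset.mem_erase.2 ⟨hvw.symm, hw⟩
      rw [← h] at hw'
      exact (Finset.mem_filter.1 hw').2
    refine ⟨fun v hv => ?_, fun u hu v hv w hw huv hvw huw => ?_⟩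
    · by_cases hvC : v ∈ C
      · exact hCeq v hvC
      · have hv' := Finset.mem_sdiff.2 ⟨hv, hvC⟩
        rw [← hdS v hv', ih1 v hv']
    · by_cases huC : u ∈ C
      · exact hclique u huC w (hC v (hC u huC v hv huv) w hw hvw) huw
      · have hu' := Finset.mem_sdiff.2 ⟨hu, huC⟩
        have hv' := hC' u hu' v hv huv
        exact ih2 u hu' v hv' w (hC' v hv' w hw hvw) huv hvw huw
  · exfalso
    push Not at hdeg
    obtain ⟨v, hv, hlt⟩ := hdeg
    have hsum := sum_degreeIn_erase (G := G) hv
    have hcard := Finset.card_erase_add_one hv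
    have hmul : (t - 2) * S.card = (t - 2) * (S.erase v).card + (t - 2) := by
      rw [← hcard, mul_add, mul_one]
    obtain ⟨ih1, ih2⟩ := ih (S.erase v) (Finset.erase_ssubset hv) (by omega)
    have hsum' : ∑ w ∈ S.erase v, G.degreeIn (S.erase v) w = (t - 2) * (S.erase v).card := by
      rw [Finset.sum_congr rfl ih1]
      simp [mul_comm]
    have hpos : 0 < G.degreeIn S v := by omega
    obtain ⟨u, hu⟩ := Finset.card_pos.1 hpos
    obtain ⟨huS, hvu⟩ := Finset.mem_filter.1 hu
    have hu' : u ∈ S.erase v := Finset.mem_erase.2 ⟨hvu.ne', huS⟩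
    have hN : ∀ w ∈ (S.erase v).filter (G.Adj u), w ∈ S.erase v ∧ G.Adj u w := fun w hw =>
      Finset.mem_filter.1 hw
    set N := (S.erase v).filter (G.Adj u) with hNdef
    have hNc : G.IsClique (N : Set V) := by
      intro a ha b hb hab
      exact ih2 a (hN a ha).1 u hu' b (hN b hb).1 (hN a ha).2.symm (hN b hb).2 hab
    have hlen := hfree (v :: u :: N.toList)
      (by
        refine List.nodup_cons.2 ⟨?_, List.nodup_cons.2 ⟨?_, N.nodup_toList⟩⟩
        · rw [List.mem_cons, not_or]
          refine ⟨hvu.ne, fun h => ?_⟩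
          exact Finset.notMem_erase v S (hN v (Finset.mem_toList.1 h)).1
        · intro h
          exact (hN u (Finset.mem_toList.1 h)).2.ne rfl)
      (List.isChain_cons_cons.2 ⟨hvu, List.isChain_cons.2 ⟨fun y hy =>
        (hN y (Finset.mem_toList.1 (List.mem_of_mem_head? hy))).2, hNc.isChain_toList⟩⟩)
    have hNcard : N.card = t - 2 := ih1 u hu'
    simp only [List.length_cons, Finset.length_toList] at hlen
    omega

end SimpleGraph

/-- equality case of Erdős–Gallai. For `t ≥ 4`, an `n`-vertex
`P_t`-subgraph-free graph `G` has exactly `((t−2)/2)·n` edges if and only if `G` is a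
vertex-disjoint union of complete graphs `K_{t−1}` (i.e. there is a labelling `c` of the
vertices such that two vertices are adjacent iff they are distinct with the same label,
and every label class has exactly `t − 1` vertices). -/
theorem erdos_gallai_path_equality {V : Type*} [Fintype V] [DecidableEq V]
    (t : ℕ) (ht : 4 ≤ t) (G : SimpleGraph V) [DecidableRel G.Adj]
    (hfree : ¬ Contains G (SimpleGraph.pathGraph t)) :
    (G.edgeFinset.card : ℚ) = ((t : ℚ) - 2) / 2 * Fintype.card V ↔
      ∃ c : V → ℕ,
        (∀ u v : V, G.Adj u v ↔ u ≠ v ∧ c u = c v) ∧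
        (∀ v : V, (Finset.univ.filter fun w => c w = c v).card = t - 1) := by
  have hdeg (v : V) : G.degreeIn Finset.univ v = G.degree v := by
    rw [SimpleGraph.degreeIn, ← G.card_neighborFinset_eq_degree, G.neighborFinset_eq_filter]
  have hsum := G.sum_degrees_eq_twice_card_edges
  have hcast : ((t - 2 : ℕ) : ℚ) = (t : ℚ) - 2 := by
    rw [Nat.cast_sub (by omega)]
    norm_num
  have hiff : (G.edgeFinset.card : ℚ) = ((t : ℚ) - 2) / 2 * Fintype.card V ↔
      2 * G.edgeFinset.card = (t - 2) * Fintype.card V := by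
    rw [← hcast, ← Nat.cast_inj (R := ℚ)]
    push_cast
    constructor <;> intro h <;> linarith
  rw [hiff, ← hsum]
  constructor
  · intro h
    obtain ⟨hd, htrans⟩ := SimpleGraph.degreeIn_eq_and_adj_trans (by omega)
      (fun _ => SimpleGraph.length_lt_of_not_contains_pathGraph hfree) Finset.univ
      (by rw [Finset.sum_congr rfl fun v _ => hdeg v, h, Finset.card_univ])
    let r : Setoid V :=
      { r := fun u v => u = v ∨ G.Adj u v
        iseqv :=
          { refl := fun _ => Or.inl rfl
            symm := fun h => h.imp Eq.symm fun h => h.symm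
            trans := by
              rintro u v w (rfl | huv) (rfl | hvw)
              · exact Or.inl rfl
              · exact Or.inr hvw
              · exact Or.inr huv
              · exact or_iff_not_imp_left.2 fun huw => htrans u (Finset.mem_univ u) v
                  (Finset.mem_univ v) w (Finset.mem_univ w) huv hvw huw } }
    obtain ⟨e, he⟩ := Countable.exists_injective_nat (Quotient r)
    have hr (u v : V) : e (Quotient.mk r u) = e (Quotient.mk r v) ↔ u = v ∨ G.Adj u v :=
      he.eq_iff.trans Quotient.eq
    refine ⟨fun v => e (Quotient.mk r v), fun u v => ?_, fun v => ?_⟩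
    · rw [hr]
      exact ⟨fun h => ⟨h.ne, Or.inr h⟩, fun h => h.2.resolve_left h.1⟩
    · have hins : (Finset.univ.filter fun w => e (Quotient.mk r w) = e (Quotient.mk r v)) =
          insert v (Finset.univ.filter (G.Adj v)) := by
        ext w
        simp [hr, G.adj_comm]
      rw [hins, Finset.card_insert_of_notMem (by simp)]
      have := hd v (Finset.mem_univ v)
      rw [SimpleGraph.degreeIn] at this
      omega
  · rintro ⟨c, hadj, hcard⟩
    have hd (v : V) : G.degree v = t - 2 := by
      have hers : Finset.univ.filter (G.Adj v) =
          (Finset.univ.filter fun w => c w = c v).erase v := by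
        ext w
        simp [hadj, eq_comm]
      rw [← hdeg, SimpleGraph.degreeIn, hers, Finset.card_erase_of_mem (by simp), hcard]
      omega
    simp [hd, mul_comm]
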